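/- For the CHSH game with each party's input independently Bernoulli distributed with parameter p ∈ [0,1], the quantum value strictly exceeds the classical value if and only if 1 − 1/√2 < p < 1/√2; i.e., w_{CHSH,p} is gapped exactly when p ∈ (1 − 1/√2, 1/√2), and gapless (q* = c*) otherwise. -/

import Mathlib

open scoped BigOperators

namespace TC

/-- A behavior: a conditional probability distribution over joint decisions given
joint observations. -/
def IsBehavior {n : ℕ} {O D : Fin n → Type} [∀ i, Fintype (D i)]
    (p : (∀ i, O i) → (∀ i, D i) → ℝ) : Prop :=
  (∀ o d, 0 ≤ p o d) ∧ ∀ o, ∑ d, p o d = 1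

/-- The behavior of a deterministic strategy `f`. -/
def detBehavior {n : ℕ} {O D : Fin n → Type} [∀ i, DecidableEq (D i)]
    (f : ∀ i, O i → D i) : (∀ i, O i) → (∀ i, D i) → ℝ :=
  fun o d => ∏ i, if d i = f i (o i) then (1 : ℝ) else 0

/-- Expected utility of a behavior `p` with respect to a weighted utility array `w`. -/
def expUtility {n : ℕ} {O D : Fin n → Type} [∀ i, Fintype (O i)] [∀ i, Fintype (D i)]
    (w p : (∀ i, O i) → (∀ i, D i) → ℝ) : ℝ :=
  ∑ o, ∑ d, p o d * w o d

/-- A quantum strategy: a finite dimension for each party, a projective measurement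
(indexed by decisions) for each party and observation, and a shared unit state vector. -/
structure QStrategy {n : ℕ} (O D : Fin n → Type) [∀ i, Fintype (O i)] [∀ i, Fintype (D i)] where
  dim : Fin n → ℕ
  dim_pos : ∀ i, 0 < dim i
  proj : ∀ i, O i → D i → Matrix (Fin (dim i)) (Fin (dim i)) ℂ
  proj_herm : ∀ i o d, (proj i o d).IsHermitian
  proj_idem : ∀ i o d, proj i o d * proj i o d = proj i o d
  proj_orth : ∀ i o d d', d ≠ d' → proj i o d * proj i o d' = 0
  proj_sum : ∀ i o, ∑ d, proj i o d = 1
  state : (∀ i, Fin (dim i)) → ℂ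
  state_norm : ∑ x, Complex.normSq (state x) = 1

/-- The behavior determined by a family of "projectors" (measurement operators, one for each
party, observation and decision) and a shared state:
`p(d|o) = ⟨ψ, (⊗ᵢ Πᵢ^{(dᵢ|oᵢ)}) ψ⟩`. -/
noncomputable def projBehavior {n : ℕ} {O D : Fin n → Type} (dim : Fin n → ℕ)
    (proj : ∀ i, O i → D i → Matrix (Fin (dim i)) (Fin (dim i)) ℂ)
    (ψ : (∀ i, Fin (dim i)) → ℂ) : (∀ i, O i) → (∀ i, D i) → ℝ :=
  fun o d =>
    (∑ x, ∑ y, (starRingEnd ℂ) (ψ x) * (∏ i, proj i (o i) (d i) (x i) (y i)) * ψ y).re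

/-- The quantum behavior of a quantum strategy. -/
noncomputable def QStrategy.behavior {n : ℕ} {O D : Fin n → Type}
    [∀ i, Fintype (O i)] [∀ i, Fintype (D i)] (S : QStrategy O D) :
    (∀ i, O i) → (∀ i, D i) → ℝ :=
  projBehavior S.dim S.proj S.state

/-- The classical value: the maximum expected utility over deterministic strategies. -/
noncomputable def cValue {n : ℕ} {O D : Fin n → Type} [∀ i, Fintype (O i)] [∀ i, Fintype (D i)]
    [∀ i, DecidableEq (D i)] (w : (∀ i, O i) → (∀ i, D i) → ℝ) : ℝ :=
  ⨆ f : ∀ i, O i → D i, expUtility w (detBehavior f)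

/-- The quantum value: the supremum of expected utilities over all quantum strategies
(of all finite dimensions). -/
noncomputable def qValue {n : ℕ} {O D : Fin n → Type} [∀ i, Fintype (O i)] [∀ i, Fintype (D i)]
    (w : (∀ i, O i) → (∀ i, D i) → ℝ) : ℝ :=
  sSup {x : ℝ | ∃ S : QStrategy O D, x = expUtility w S.behavior}

/-- The gap `g(w) = q*(w) − c*(w)`. -/
noncomputable def gap {n : ℕ} {O D : Fin n → Type} [∀ i, Fintype (O i)] [∀ i, Fintype (D i)]
    [∀ i, DecidableEq (D i)] (w : (∀ i, O i) → (∀ i, D i) → ℝ) : ℝ :=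
  qValue w - cValue w

/-- `w` is gapped if its gap is positive. -/
def Gapped {n : ℕ} {O D : Fin n → Type} [∀ i, Fintype (O i)] [∀ i, Fintype (D i)]
    [∀ i, DecidableEq (D i)] (w : (∀ i, O i) → (∀ i, D i) → ℝ) : Prop :=
  0 < gap w

/-- A quantum strategy is degenerate if some party uses a trivial (zero or identity)
measurement operator. -/
def QStrategy.Degenerate {n : ℕ} {O D : Fin n → Type}
    [∀ i, Fintype (O i)] [∀ i, Fintype (D i)] (S : QStrategy O D) : Prop :=
  ∃ i o d, S.proj i o d = 0 ∨ S.proj i o d = 1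

/-- A classical behavior: a convex combination of deterministic behaviors. -/
def IsClassicalBehavior {n : ℕ} {O D : Fin n → Type}
    [∀ i, Fintype (O i)] [∀ i, DecidableEq (O i)] [∀ i, Fintype (D i)] [∀ i, DecidableEq (D i)]
    (p : (∀ i, O i) → (∀ i, D i) → ℝ) : Prop :=
  ∃ μ : (∀ i, O i → D i) → ℝ, (∀ f, 0 ≤ μ f) ∧ ∑ f, μ f = 1 ∧
    ∀ o d, p o d = ∑ f, μ f * detBehavior f o d

/-- The lossy behavior built from a family of measurement operators, a shared state, a fallback
deterministic strategy `f`, and efficiencies `η`: the sum over subsets `T` of parties that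
experience loss, weighted by the loss probabilities, of the behavior of the `T`-semiclassical
strategy (parties in `T` use the trivial projectors implementing `f` locally). -/
noncomputable def lossyProjBehavior {n : ℕ} {O D : Fin n → Type} [∀ i, DecidableEq (D i)]
    (dim : Fin n → ℕ) (proj : ∀ i, O i → D i → Matrix (Fin (dim i)) (Fin (dim i)) ℂ)
    (ψ : (∀ i, Fin (dim i)) → ℂ) (f : ∀ i, O i → D i) (η : Fin n → ℝ) :
    (∀ i, O i) → (∀ i, D i) → ℝ :=
  fun o d => ∑ T : Finset (Fin n),
    ((∏ i ∈ T, (1 - η i)) * ∏ i ∈ Tᶜ, η i) *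
      projBehavior dim
        (fun i oi di =>
          if i ∈ T then (if di = f i oi then (1 : Matrix (Fin (dim i)) (Fin (dim i)) ℂ) else 0)
          else proj i oi di)
        ψ o d

/-- The `{ηᵢ}`-lossy behavior of a pair `(S_q, S_d)` of a quantum strategy and a fallback
deterministic strategy. -/
noncomputable def lossyBehavior {n : ℕ} {O D : Fin n → Type}
    [∀ i, Fintype (O i)] [∀ i, Fintype (D i)] [∀ i, DecidableEq (D i)]
    (S : QStrategy O D) (f : ∀ i, O i → D i) (η : Fin n → ℝ) :
    (∀ i, O i) → (∀ i, D i) → ℝ :=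
  lossyProjBehavior S.dim S.proj S.state f η

/-- The `ν`-noisy behavior of a quantum strategy:
`p_o^d(ν) = tr[(⊗ᵢ Πᵢ^{(dᵢ|oᵢ)}) ((1−ν)|ψ⟩⟨ψ| + ν π)]` with `π` the maximally mixed state. -/
noncomputable def noisyBehavior {n : ℕ} {O D : Fin n → Type}
    [∀ i, Fintype (O i)] [∀ i, Fintype (D i)] (S : QStrategy O D) (ν : ℝ) :
    (∀ i, O i) → (∀ i, D i) → ℝ :=
  fun o d =>
    (∑ x, ∑ y, (∏ i, S.proj i (o i) (d i) (x i) (y i)) *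
      ((1 - ν) * (S.state y * (starRingEnd ℂ) (S.state x)) +
        ((ν : ℂ) / (∏ i, (S.dim i : ℂ))) * (if x = y then 1 else 0))).re

end TC

namespace TC

/-- The CHSH weighted utility array with each party's input independently Bernoulli
distributed with parameter `p`: `w(o;d) = p^{o₁+o₂}(1−p)^{2−o₁−o₂}·χ[(o₁∧o₂) = d₁⊕d₂]`
(observation `true` is drawn with probability `p`). -/
noncomputable def wCHSHp (p : ℝ) : (Fin 2 → Bool) → (Fin 2 → Bool) → ℝ :=
  fun o d => (if o 0 then p else 1 - p) * (if o 1 then p else 1 - p) *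
    (if (o 0 && o 1) = (d 0 != d 1) then 1 else 0)

end TC

namespace TC

open Matrix
open scoped ComplexOrder

lemma sum_fin_two_bool (F : (Fin 2 → Bool) → ℝ) :
    ∑ o, F o = F ![false, false] + F ![false, true] + F ![true, false] + F ![true, true] := by
  rw [← (finTwoArrowEquiv Bool).symm.sum_comp, Fintype.sum_prod_type]
  simp [finTwoArrowEquiv]
  ring

/-- The expected utility of a behavior in the CHSH game, as the sum over winning outcomes. -/
lemma expUtility_wCHSHp (p : ℝ) (P : (Fin 2 → Bool) → (Fin 2 → Bool) → ℝ) :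
    expUtility (O := fun _ : Fin 2 => Bool) (D := fun _ : Fin 2 => Bool) (wCHSHp p) P =
      (1 - p) ^ 2 * (P ![false, false] ![false, false] + P ![false, false] ![true, true]) +
      (1 - p) * p * (P ![false, true] ![false, false] + P ![false, true] ![true, true]) +
      (1 - p) * p * (P ![true, false] ![false, false] + P ![true, false] ![true, true]) +
      p ^ 2 * (P ![true, true] ![false, true] + P ![true, true] ![true, false]) := by
  have h : expUtility (O := fun _ : Fin 2 => Bool) (D := fun _ : Fin 2 => Bool) (wCHSHp p) P =
      ∑ o : Fin 2 → Bool, ∑ d : Fin 2 → Bool, P o d * wCHSHp p o d := rfl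
  rw [h]
  simp only [sum_fin_two_bool]
  simp [wCHSHp]
  ring

lemma expUtility_wCHSHp_detBehavior (p : ℝ) (f : Fin 2 → Bool → Bool) :
    expUtility (O := fun _ : Fin 2 => Bool) (D := fun _ : Fin 2 => Bool) (wCHSHp p)
        (detBehavior f) =
      (1 - p) ^ 2 * (if f 0 false = f 1 false then 1 else 0) +
      (1 - p) * p * (if f 0 false = f 1 true then 1 else 0) +
      (1 - p) * p * (if f 0 true = f 1 false then 1 else 0) +
      p ^ 2 * (if f 0 true = f 1 true then 0 else 1) := by
  rw [expUtility_wCHSHp]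
  simp only [detBehavior, Fin.prod_univ_two]
  rcases h1 : f 0 false <;> rcases h2 : f 0 true <;> rcases h3 : f 1 false <;>
    rcases h4 : f 1 true <;> simp [h1, h2, h3, h4]

lemma le_cValue (p : ℝ) (f : Fin 2 → Bool → Bool) :
    expUtility (O := fun _ : Fin 2 => Bool) (D := fun _ : Fin 2 => Bool) (wCHSHp p)
        (detBehavior f) ≤
      cValue (O := fun _ : Fin 2 => Bool) (D := fun _ : Fin 2 => Bool) (wCHSHp p) :=
  le_ciSup (f := fun f : Fin 2 → Bool → Bool =>
    expUtility (O := fun _ : Fin 2 => Bool) (D := fun _ : Fin 2 => Bool) (wCHSHp p)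
        (detBehavior f)) (Set.finite_range _).bddAbove f

lemma cValue_wCHSHp_le {p : ℝ} (hp0 : 0 ≤ p) (hp1 : p ≤ 1) {M : ℝ} (h0 : 1 - p ^ 2 ≤ M)
    (h1 : 1 - (1 - p) ^ 2 ≤ M) :
    cValue (O := fun _ : Fin 2 => Bool) (D := fun _ : Fin 2 => Bool) (wCHSHp p) ≤ M := by
  refine ciSup_le fun f => ?_
  rw [expUtility_wCHSHp_detBehavior]
  have hb : 0 ≤ (1 - p) * p := mul_nonneg (by linarith) hp0
  have hM : 1 - (1 - p) * p ≤ M := by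
    rcases le_total p (1 / 2) with h | h <;> nlinarith
  cases f 0 false <;> cases f 0 true <;> cases f 1 false <;> cases f 1 true <;> simp <;>
    nlinarith [sq_nonneg p, sq_nonneg (1 - p)]

lemma one_sub_sq_le_cValue (p : ℝ) :
    1 - p ^ 2 ≤ cValue (O := fun _ : Fin 2 => Bool) (D := fun _ : Fin 2 => Bool) (wCHSHp p) := by
  refine le_trans (le_of_eq ?_) (le_cValue p fun _ _ => false)
  rw [expUtility_wCHSHp_detBehavior]
  simp
  ring

lemma one_sub_one_sub_sq_le_cValue (p : ℝ) :
    1 - (1 - p) ^ 2 ≤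
      cValue (O := fun _ : Fin 2 => Bool) (D := fun _ : Fin 2 => Bool) (wCHSHp p) := by
  refine le_trans (le_of_eq ?_) (le_cValue p ![id, not])
  rw [expUtility_wCHSHp_detBehavior]
  simp
  ring

lemma isHermitian_real_smul {X : Type*} {M : Matrix X X ℂ} (h : M.IsHermitian) (r : ℝ) :
    (r • M).IsHermitian := by
  rw [IsHermitian, conjTranspose_smul, h.eq]
  simp

section Quadratic

variable {X : Type*} [Fintype X]

/-- The expectation `Re ⟨ψ, M ψ⟩` of a matrix in the state `ψ`, as a linear functional. -/
noncomputable def expectation (ψ : X → ℂ) : Matrix X X ℂ →ₗ[ℝ] ℝ where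
  toFun M := (star ψ ⬝ᵥ M *ᵥ ψ).re
  map_add' M N := by simp [add_mulVec, dotProduct_add]
  map_smul' r M := by simp [smul_mulVec, dotProduct_smul]

lemma expectation_apply (ψ : X → ℂ) (M : Matrix X X ℂ) :
    expectation ψ M = (star ψ ⬝ᵥ M *ᵥ ψ).re := rfl

lemma expectation_one [DecidableEq X] {ψ : X → ℂ} (h : ∑ x, Complex.normSq (ψ x) = 1) :
    expectation ψ 1 = 1 := by
  rw [expectation_apply, one_mulVec, ← h]
  simp [dotProduct, Complex.normSq_apply]

lemma expectation_sq_nonneg (ψ : X → ℂ) {M : Matrix X X ℂ} (h : M.IsHermitian) :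
    0 ≤ expectation ψ (M * M) := by
  have := (posSemidef_conjTranspose_mul_self M).re_dotProduct_nonneg ψ
  rwa [h.eq] at this

/-- Expectation of the square of a real combination of three observables, the third
commuting with the other two. -/
lemma expectation_combination_nonneg [DecidableEq X] {ψ : X → ℂ} (hψ : expectation ψ 1 = 1)
    {A B C : Matrix X X ℂ} (hA : A.IsHermitian) (hB : B.IsHermitian) (hC : C.IsHermitian)
    (hAA : A * A = 1) (hBB : B * B = 1) (hCC : C * C = 1) (hAC : C * A = A * C)
    (hBC : C * B = B * C) (x y z : ℝ) :
    0 ≤ x ^ 2 + y ^ 2 + z ^ 2 + x * y * expectation ψ (A * B + B * A) +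
      2 * x * z * expectation ψ (A * C) + 2 * y * z * expectation ψ (B * C) := by
  have h := expectation_sq_nonneg ψ (((isHermitian_real_smul hA x).add
    (isHermitian_real_smul hB y)).add (isHermitian_real_smul hC z))
  simp only [add_mul, mul_add, smul_mul_smul_comm, hAA, hBB, hCC, hAC, hBC, map_add, map_smul,
    hψ, smul_eq_mul] at h
  rw [map_add]
  linarith

end Quadratic

/-- The four `±1`-valued observables of a two-party two-setting experiment. -/
structure IsCHSHObservables {X : Type*} [Fintype X] [DecidableEq X]
    (A B : Bool → Matrix X X ℂ) : Prop where
  hermA : ∀ o, (A o).IsHermitian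
  hermB : ∀ o, (B o).IsHermitian
  sqA : ∀ o, A o * A o = 1
  sqB : ∀ o, B o * B o = 1
  comm : ∀ o o', B o' * A o = A o * B o'

namespace IsCHSHObservables

variable {X : Type*} [Fintype X] [DecidableEq X] {A B : Bool → Matrix X X ℂ} {ψ : X → ℂ}

lemma combination_nonneg (h : IsCHSHObservables A B) (hψ : expectation ψ 1 = 1) (o : Bool)
    (x y z : ℝ) :
    0 ≤ x ^ 2 + y ^ 2 + z ^ 2 +
      x * y * expectation ψ (A false * A true + A true * A false) +
      2 * x * z * expectation ψ (A false * B o) + 2 * y * z * expectation ψ (A true * B o) :=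
  expectation_combination_nonneg hψ (h.hermA _) (h.hermA _) (h.hermB _) (h.sqA _) (h.sqA _)
    (h.sqB _) (h.comm _ _) (h.comm _ _) x y z

lemma abs_expectation_le_one (h : IsCHSHObservables A B) (hψ : expectation ψ 1 = 1)
    (o o' : Bool) : |expectation ψ (A o * B o')| ≤ 1 := by
  rw [abs_le]
  cases o
  · have h1 := h.combination_nonneg hψ o' 1 0 1
    have h2 := h.combination_nonneg hψ o' 1 0 (-1)
    constructor <;> linarith
  · have h1 := h.combination_nonneg hψ o' 0 1 1
    have h2 := h.combination_nonneg hψ o' 0 1 (-1)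
    constructor <;> linarith

lemma chsh_le_of_left (h : IsCHSHObservables A B) (hψ : expectation ψ 1 = 1)
    {r p : ℝ} (hp : 0 ≤ p) (hrp : p < r) (hsum : r + p = 1) (hc : 2 * r * p + p ^ 2 ≤ r ^ 2) :
    r ^ 2 * expectation ψ (A false * B false) + r * p * expectation ψ (A false * B true) +
      r * p * expectation ψ (A true * B false) - p ^ 2 * expectation ψ (A true * B true) ≤
      1 - 2 * p ^ 2 := by
  have h1 := h.combination_nonneg hψ false r p (-1)
  have h2 := h.combination_nonneg hψ true r (-p) (-(r - p))
  have h3 := h.combination_nonneg hψ false 1 (-1) 0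
  generalize expectation ψ (A false * A true + A true * A false) = S at *
  generalize expectation ψ (A false * B false) = u at *
  generalize expectation ψ (A true * B false) = v at *
  generalize expectation ψ (A false * B true) = w at *
  generalize expectation ψ (A true * B true) = z at *
  have hd : 0 < r - p := by linarith
  have hr : 0 ≤ r := by linarith
  have k1 := mul_nonneg (mul_nonneg hr hd.le) h1
  have k2 := mul_nonneg hp h2
  have k3 := mul_nonneg (mul_nonneg (mul_nonneg hr hp) (sub_nonneg.2 hc)) h3
  refine le_of_mul_le_mul_left ?_ hd
  obtain rfl : r = 1 - p := by linarith
  nlinarith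

/-- The relabelling exchanging the roles of the settings `false` and `true`. -/
lemma swap (h : IsCHSHObservables A B) :
    IsCHSHObservables (fun o => bif o then -A false else A true)
      (fun o => bif o then B false else -B true) where
  hermA o := by cases o <;> simp [h.hermA, IsHermitian.neg]
  hermB o := by cases o <;> simp [h.hermB, IsHermitian.neg]
  sqA o := by cases o <;> simp [h.sqA]
  sqB o := by cases o <;> simp [h.sqB]
  comm o o' := by cases o <;> cases o' <;> simp [h.comm]

lemma chsh_le_of_right (h : IsCHSHObservables A B) (hψ : expectation ψ 1 = 1)
    {r p : ℝ} (hr : 0 ≤ r) (hrp : r < p) (hsum : r + p = 1) (hc : 2 * r * p + r ^ 2 ≤ p ^ 2) :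
    r ^ 2 * expectation ψ (A false * B false) + r * p * expectation ψ (A false * B true) +
      r * p * expectation ψ (A true * B false) - p ^ 2 * expectation ψ (A true * B true) ≤
      1 - 2 * r ^ 2 := by
  have := h.swap.chsh_le_of_left hψ hr hrp (by linarith) (by linarith)
  simp only [cond_false, cond_true, mul_neg, neg_mul, neg_neg, map_neg] at this
  linarith

end IsCHSHObservables

section Tensor

variable {dim : Fin 2 → ℕ}

/-- The tensor product of two matrices, acting on functions on the product index set. -/
def tensor (M : Matrix (Fin (dim 0)) (Fin (dim 0)) ℂ) (N : Matrix (Fin (dim 1)) (Fin (dim 1)) ℂ) :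
    Matrix (∀ i, Fin (dim i)) (∀ i, Fin (dim i)) ℂ :=
  fun x y => M (x 0) (y 0) * N (x 1) (y 1)

variable (M M' : Matrix (Fin (dim 0)) (Fin (dim 0)) ℂ) (N N' : Matrix (Fin (dim 1)) (Fin (dim 1)) ℂ)

lemma tensor_mul : tensor M N * tensor M' N' = tensor (M * M') (N * N') := by
  ext x y
  simp only [mul_apply, tensor]
  rw [← (piFinTwoEquiv fun i => Fin (dim i)).symm.sum_comp, Fintype.sum_prod_type,
    Finset.sum_mul_sum]
  refine Finset.sum_congr rfl fun i _ => Finset.sum_congr rfl fun j _ => ?_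
  simp [piFinTwoEquiv]
  ring

lemma tensor_one : tensor (1 : Matrix (Fin (dim 0)) (Fin (dim 0)) ℂ)
    (1 : Matrix (Fin (dim 1)) (Fin (dim 1)) ℂ) = 1 := by
  ext x y
  simp only [tensor, one_apply, funext_iff, Fin.forall_fin_two]
  split_ifs <;> simp_all

lemma tensor_add_left : tensor (M + M') N = tensor M N + tensor M' N := by
  ext x y
  simp [tensor, add_mul]

lemma tensor_sub_left : tensor (M - M') N = tensor M N - tensor M' N := by
  ext x y
  simp [tensor, sub_mul]

lemma tensor_add_right : tensor M (N + N') = tensor M N + tensor M N' := by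
  ext x y
  simp [tensor, mul_add]

lemma tensor_sub_right : tensor M (N - N') = tensor M N - tensor M N' := by
  ext x y
  simp [tensor, mul_sub]

variable {M N} in
lemma isHermitian_tensor (hM : M.IsHermitian) (hN : N.IsHermitian) :
    (tensor M N).IsHermitian := by
  ext x y
  simp only [conjTranspose_apply, tensor, star_mul', hM.apply, hN.apply]

end Tensor

namespace QStrategy

variable (S : QStrategy (fun _ : Fin 2 => Bool) (fun _ : Fin 2 => Bool))

lemma behavior_eq (o d : Fin 2 → Bool) :
    S.behavior o d =
      expectation S.state (tensor (S.proj 0 (o 0) (d 0)) (S.proj 1 (o 1) (d 1))) := by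
  simp only [behavior, projBehavior, Fin.prod_univ_two, expectation_apply, dotProduct, mulVec,
    tensor, Finset.mul_sum, Pi.star_apply]
  congr 1
  refine Finset.sum_congr rfl fun x _ => Finset.sum_congr rfl fun y _ => ?_
  rw [mul_assoc]
  rfl

/-- The `±1`-valued observable of a party for a given observation. -/
def observable (i : Fin 2) (o : Bool) : Matrix (Fin (S.dim i)) (Fin (S.dim i)) ℂ :=
  S.proj i o false - S.proj i o true

lemma proj_add (i : Fin 2) (o : Bool) : S.proj i o false + S.proj i o true = 1 := by
  rw [← S.proj_sum i o, Fintype.sum_bool, add_comm]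

lemma observable_herm (i : Fin 2) (o : Bool) : (S.observable i o).IsHermitian :=
  (S.proj_herm i o false).sub (S.proj_herm i o true)

lemma observable_sq (i : Fin 2) (o : Bool) : S.observable i o * S.observable i o = 1 := by
  simp only [observable, sub_mul, mul_sub, S.proj_idem, S.proj_orth i o false true (by simp),
    S.proj_orth i o true false (by simp), ← S.proj_add i o]
  abel

lemma isCHSHObservables :
    IsCHSHObservables (fun o => tensor (S.observable 0 o) 1)
      (fun o => tensor 1 (S.observable 1 o)) where
  hermA o := isHermitian_tensor (S.observable_herm 0 o) isHermitian_one
  hermB o := isHermitian_tensor isHermitian_one (S.observable_herm 1 o)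
  sqA o := by rw [tensor_mul, S.observable_sq, one_mul, tensor_one]
  sqB o := by rw [tensor_mul, S.observable_sq, one_mul, tensor_one]
  comm o o' := by simp only [tensor_mul, one_mul, mul_one]

/-- The expectation of the product of the two parties' outcomes. -/
noncomputable def correlator (o o' : Bool) : ℝ :=
  expectation S.state (tensor (S.observable 0 o) 1 * tensor 1 (S.observable 1 o'))

lemma expectation_state_one : expectation S.state 1 = 1 :=
  expectation_one S.state_norm

lemma behavior_sums (o o' : Bool) :
    S.behavior ![o, o'] ![false, false] + S.behavior ![o, o'] ![true, true] =
      (1 + S.correlator o o') / 2 ∧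
    S.behavior ![o, o'] ![false, true] + S.behavior ![o, o'] ![true, false] =
      (1 - S.correlator o o') / 2 := by
  have h := S.expectation_state_one
  rw [← tensor_one, ← S.proj_add 0 o, ← S.proj_add 1 o'] at h
  simp only [tensor_add_left, tensor_add_right, map_add] at h
  simp only [correlator, tensor_mul, one_mul, mul_one]
  simp only [behavior_eq, observable, tensor_sub_left, tensor_sub_right, map_sub, cons_val_zero,
    cons_val_one]
  constructor <;> linarith

lemma expUtility_eq (p : ℝ) :
    expUtility (wCHSHp p) S.behavior =
      (1 + ((1 - p) ^ 2 * S.correlator false false + (1 - p) * p * S.correlator false true +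
        (1 - p) * p * S.correlator true false - p ^ 2 * S.correlator true true)) / 2 := by
  rw [expUtility_wCHSHp, (S.behavior_sums _ _).1, (S.behavior_sums _ _).1,
    (S.behavior_sums _ _).1, (S.behavior_sums _ _).2]
  ring

lemma expUtility_le_one {p : ℝ} (hp0 : 0 ≤ p) (hp1 : p ≤ 1) :
    expUtility (wCHSHp p) S.behavior ≤ 1 := by
  have h (o o' : Bool) : |S.correlator o o'| ≤ 1 :=
    S.isCHSHObservables.abs_expectation_le_one S.expectation_state_one o o'
  have hb : 0 ≤ (1 - p) * p := mul_nonneg (by linarith) hp0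
  rw [expUtility_eq]
  nlinarith [mul_le_mul_of_nonneg_left (abs_le.1 (h false false)).2 (sq_nonneg (1 - p)),
    mul_le_mul_of_nonneg_left (abs_le.1 (h false true)).2 hb,
    mul_le_mul_of_nonneg_left (abs_le.1 (h true false)).2 hb,
    mul_le_mul_of_nonneg_left (abs_le.1 (h true true)).1 (sq_nonneg p)]

end QStrategy

lemma qValue_le_of_left {p : ℝ} (hp0 : 0 ≤ p) (hp : p < 1 / 2)
    (hc : 2 * (1 - p) * p + p ^ 2 ≤ (1 - p) ^ 2) :
    qValue (O := fun _ : Fin 2 => Bool) (D := fun _ : Fin 2 => Bool) (wCHSHp p) ≤ 1 - p ^ 2 := by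
  refine Real.sSup_le ?_ (by nlinarith)
  rintro _ ⟨S, rfl⟩
  have := S.isCHSHObservables.chsh_le_of_left S.expectation_state_one hp0
    (r := 1 - p) (by linarith) (by ring) hc
  rw [S.expUtility_eq]
  simp only [QStrategy.correlator]
  linarith

lemma qValue_le_of_right {p : ℝ} (hp1 : p ≤ 1) (hp : 1 / 2 < p)
    (hc : 2 * (1 - p) * p + (1 - p) ^ 2 ≤ p ^ 2) :
    qValue (O := fun _ : Fin 2 => Bool) (D := fun _ : Fin 2 => Bool) (wCHSHp p) ≤
      1 - (1 - p) ^ 2 := by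
  refine Real.sSup_le ?_ (by nlinarith)
  rintro _ ⟨S, rfl⟩
  have := S.isCHSHObservables.chsh_le_of_right S.expectation_state_one
    (r := 1 - p) (p := p) (by linarith) (by linarith) (by ring) hc
  rw [S.expUtility_eq]
  simp only [QStrategy.correlator]
  linarith

/-- The spectral projections of the reflection with matrix `!![c, s; s, -c]`. -/
noncomputable def reflectionProj (c s : ℝ) (d : Bool) : Matrix (Fin 2) (Fin 2) ℂ :=
  bif d then !![((1 - c) / 2 : ℂ), -s / 2; -s / 2, (1 + c) / 2]
  else !![((1 + c) / 2 : ℂ), s / 2; s / 2, (1 - c) / 2]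

lemma reflectionProj_herm (c s : ℝ) (d : Bool) : (reflectionProj c s d).IsHermitian := by
  ext i j
  cases d <;> fin_cases i <;> fin_cases j <;> simp [reflectionProj]

lemma reflectionProj_idem {c s : ℝ} (h : c ^ 2 + s ^ 2 = 1) (d : Bool) :
    reflectionProj c s d * reflectionProj c s d = reflectionProj c s d := by
  have h' : (c : ℂ) ^ 2 + (s : ℂ) ^ 2 = 1 := by exact_mod_cast h
  ext i j
  cases d <;> fin_cases i <;> fin_cases j <;>
    simp [reflectionProj, mul_apply, Fin.sum_univ_two] <;>
    first | ring1 | linear_combination (1 / 4) * h'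

lemma reflectionProj_orth {c s : ℝ} (h : c ^ 2 + s ^ 2 = 1) {d d' : Bool} (hd : d ≠ d') :
    reflectionProj c s d * reflectionProj c s d' = 0 := by
  have h' : (c : ℂ) ^ 2 + (s : ℂ) ^ 2 = 1 := by exact_mod_cast h
  ext i j
  cases d <;> cases d' <;> simp at hd <;> fin_cases i <;> fin_cases j <;>
    simp [reflectionProj, mul_apply, Fin.sum_univ_two] <;>
    first | ring1 | linear_combination (-1 / 4) * h'

lemma reflectionProj_sum (c s : ℝ) : ∑ d, reflectionProj c s d = 1 := by
  ext i j
  fin_cases i <;> fin_cases j <;> simp [reflectionProj] <;> ring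

lemma reflectionProj_false_sub_true (c s : ℝ) :
    reflectionProj c s false - reflectionProj c s true = !![(c : ℂ), s; s, -c] := by
  ext i j
  fin_cases i <;> fin_cases j <;> simp [reflectionProj] <;> ring

lemma sum_fin_two_fin_two {R : Type*} [AddCommMonoid R] (F : (Fin 2 → Fin 2) → R) :
    ∑ o, F o = F ![0, 0] + F ![0, 1] + (F ![1, 0] + F ![1, 1]) := by
  rw [← (finTwoArrowEquiv (Fin 2)).symm.sum_comp, Fintype.sum_prod_type]
  simp [finTwoArrowEquiv]

/-- The strategy measuring a maximally entangled pair of qubits along the reflections with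
axes `(c i o, s i o)`. -/
noncomputable def qubitStrategy (c s : Fin 2 → Bool → ℝ) (h : ∀ i o, c i o ^ 2 + s i o ^ 2 = 1) :
    QStrategy (fun _ : Fin 2 => Bool) (fun _ : Fin 2 => Bool) where
  dim _ := 2
  dim_pos _ := two_pos
  proj i o d := reflectionProj (c i o) (s i o) d
  proj_herm i o d := reflectionProj_herm _ _ d
  proj_idem i o d := reflectionProj_idem (h i o) d
  proj_orth i o _ _ hd := reflectionProj_orth (h i o) hd
  proj_sum i o := reflectionProj_sum _ _
  state x := if x 0 = x 1 then ((√2 / 2 : ℝ) : ℂ) else 0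
  state_norm := by
    refine (sum_fin_two_fin_two _).trans ?_
    have : √2 * √2 = 2 := Real.mul_self_sqrt (by norm_num)
    simp [Complex.normSq_apply]
    linarith

lemma qubitStrategy_correlator (c s : Fin 2 → Bool → ℝ) (h : ∀ i o, c i o ^ 2 + s i o ^ 2 = 1)
    (o o' : Bool) :
    (qubitStrategy c s h).correlator o o' = c 0 o * c 1 o' + s 0 o * s 1 o' := by
  have h2 : √2 * √2 = 2 := Real.mul_self_sqrt (by norm_num)
  rw [QStrategy.correlator, tensor_mul, one_mul, mul_one, expectation_apply]
  let ψ : (Fin 2 → Fin 2) → ℂ := (qubitStrategy c s h).state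
  let T : Matrix (Fin 2 → Fin 2) (Fin 2 → Fin 2) ℂ := tensor (dim := fun _ => 2)
    (reflectionProj (c 0 o) (s 0 o) false - reflectionProj (c 0 o) (s 0 o) true)
    (reflectionProj (c 1 o') (s 1 o') false - reflectionProj (c 1 o') (s 1 o') true)
  change (∑ x : Fin 2 → Fin 2, star (ψ x) * ∑ y : Fin 2 → Fin 2, T x y * ψ y).re = _
  simp only [sum_fin_two_fin_two, ψ, T, reflectionProj_false_sub_true]
  simp [qubitStrategy, tensor]
  linear_combination ((c 0 o * c 1 o' + s 0 o * s 1 o') / 2) * h2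

lemma le_qValue {p : ℝ} (hp0 : 0 ≤ p) (hp1 : p ≤ 1) (c s : Fin 2 → Bool → ℝ)
    (h : ∀ i o, c i o ^ 2 + s i o ^ 2 = 1) :
    (1 + ((1 - p) ^ 2 * (c 0 false * c 1 false + s 0 false * s 1 false) +
      (1 - p) * p * (c 0 false * c 1 true + s 0 false * s 1 true) +
      (1 - p) * p * (c 0 true * c 1 false + s 0 true * s 1 false) -
      p ^ 2 * (c 0 true * c 1 true + s 0 true * s 1 true))) / 2 ≤
      qValue (O := fun _ : Fin 2 => Bool) (D := fun _ : Fin 2 => Bool) (wCHSHp p) := by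
  refine le_csSup ⟨1, ?_⟩ ⟨qubitStrategy c s h, ?_⟩
  · rintro _ ⟨S, rfl⟩
    exact S.expUtility_le_one hp0 hp1
  · simp only [QStrategy.expUtility_eq, qubitStrategy_correlator]

/-- In the range where the two-party Cauchy–Schwarz bound can be saturated, the quantum value
attains it. -/
lemma sqrt_two_bound_le_qValue {p : ℝ} (hp0 : 0 < p) (hp1 : p < 1)
    (h : ((1 - p) ^ 2 - p ^ 2) ^ 2 ≤ (2 * (1 - p) * p) ^ 2) :
    (1 + √2 * ((1 - p) ^ 2 + p ^ 2)) / 2 ≤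
      qValue (O := fun _ : Fin 2 => Bool) (D := fun _ : Fin 2 => Bool) (wCHSHp p) := by
  have hr : 0 < 1 - p := by linarith
  have h2 : √2 ^ 2 = 2 := Real.sq_sqrt (by norm_num)
  have h2' : √2 ≠ 0 := by positivity
  obtain ⟨r, hrdef⟩ : ∃ r, r = 1 - p := ⟨_, rfl⟩
  rw [← hrdef] at h hr
  have hden : 2 * r * p ≠ 0 := by positivity
  obtain ⟨t, ht⟩ : ∃ t, t = (r ^ 2 - p ^ 2) / (2 * r * p) := ⟨_, rfl⟩
  have ht' : 2 * r * p * t = r ^ 2 - p ^ 2 := by rw [ht]; field_simp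
  have ht1 : t ^ 2 ≤ 1 := by
    rw [ht, div_pow]
    exact div_le_one_of_le₀ h (sq_nonneg _)
  obtain ⟨y, hy⟩ : ∃ y, y ^ 2 = 1 - t ^ 2 := ⟨√(1 - t ^ 2), Real.sq_sqrt (by linarith)⟩
  have key := le_qValue hp0.le hp1.le
    ![fun o => bif o then t else 1,
      fun o => bif o then (r - p * t) / (√2 * p) else (r + p * t) / (√2 * r)]
    ![fun o => bif o then y else 0,
      fun o => bif o then -(p * y) / (√2 * p) else p * y / (√2 * r)] (by
    rw [Fin.forall_fin_two]
    constructor <;> intro o <;> cases o <;> simp [div_pow, mul_pow, h2]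
    · linarith
    · field_simp
      linear_combination p ^ 2 * hy + ht'
    · field_simp
      linear_combination p ^ 2 * hy - ht')
  refine le_trans (le_of_eq ?_) key
  simp [← hrdef]
  field_simp
  rw [h2]
  linear_combination -2 * p ^ 2 * hy

end TC

open TC in
/-- the CHSH game with independent Bernoulli(p) inputs is gapped (its quantum
value strictly exceeds its classical value) if and only if `1 − 1/√2 < p < 1/√2`. -/
theorem gapped_wCHSHp_iff (p : ℝ) (hp0 : 0 ≤ p) (hp1 : p ≤ 1) :
    Gapped (O := fun _ : Fin 2 => Bool) (D := fun _ : Fin 2 => Bool) (wCHSHp p) ↔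
      (1 - 1 / Real.sqrt 2 < p ∧ p < 1 / Real.sqrt 2) := by
  
  have h2 : √2 ^ 2 = 2 := Real.sq_sqrt (by norm_num)
  have h1 : 1 < √2 := by rw [Real.lt_sqrt] <;> norm_num
  have hinv : 1 / √2 = √2 / 2 := by field_simp; linarith
  have h32 : √2 < 3 / 2 := by nlinarith
  rw [Gapped, gap, sub_pos, hinv]
  constructor
  · intro hgap
    constructor
    · by_contra! hp
      refine absurd hgap (not_lt.2 ((qValue_le_of_left hp0 (by linarith) ?_).trans
        (one_sub_sq_le_cValue p)))
      nlinarith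
    · by_contra! hp
      refine absurd hgap (not_lt.2 ((qValue_le_of_right hp1 (by linarith) ?_).trans
        (one_sub_one_sub_sq_le_cValue p)))
      nlinarith
  · rintro ⟨hl, hr⟩
    have hpos : 0 < p := by linarith
    have hlt : p < 1 := by linarith
    have hq := sqrt_two_bound_le_qValue hpos hlt (by
      have ha : 0 ≤ 2 * (1 - p) * p - ((1 - p) ^ 2 - p ^ 2) := by nlinarith
      have hb : 0 ≤ 2 * (1 - p) * p + ((1 - p) ^ 2 - p ^ 2) := by nlinarith
      nlinarith [mul_nonneg ha hb])
    obtain ⟨M, hM, hMq⟩ : ∃ M, max (1 - p ^ 2) (1 - (1 - p) ^ 2) = M ∧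
        M < (1 + √2 * ((1 - p) ^ 2 + p ^ 2)) / 2 := by
      refine ⟨_, rfl, max_lt ?_ ?_⟩
      · have := mul_pos (sub_pos.2 h1) (pow_pos (sub_pos.2 hl) 2)
        nlinarith
      · have := mul_pos (sub_pos.2 h1) (pow_pos (sub_pos.2 hr) 2)
        nlinarith
    exact (cValue_wCHSHp_le hp0 hp1 (hM ▸ le_max_left _ _) (hM ▸ le_max_right _ _)).trans_lt
      (hMq.trans_le hq)
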